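/- Let k ≤ k̄ ≤ n with (log n)^5 ≤ k̄ = o(n) and let ε > 0 be an arbitrarily small constant, and suppose k = ω(√n). Then there exists a sufficiently large constant C₀ = C₀(ε) > 0 such that, on the discretized interval I = ℤ ∩ [⌊C₀·k̄k/n⌋, (1−ε)k], for all sufficiently large n: (2i) if k̄ = o(n²/(k²·log(k²/n))) then the function z ↦ Γ_{k̄,k}(z) is non-monotonic on I; (2ii) if k̄ = ω(n²/(k²·log(k²/n))) then z ↦ Γ_{k̄,k}(z) is increasing on I. -/

import Mathlib

open Filter MeasureTheory Finset

noncomputable section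

/-- The natural-log binary entropy function. -/
noncomputable def binEnt (x : ℝ) : ℝ := -(x * Real.log x) - (1 - x) * Real.log (1 - x)

/-- The inverse of the binary entropy restricted to `[1/2, 1]`. -/
noncomputable def binEntInv (y : ℝ) : ℝ :=
  Function.invFunOn binEnt (Set.Icc (1/2 : ℝ) 1) y

/-- The first moment curve `Γ_{k̄,k}(z)`, with the convention `Γ_{k,k}(k) = C(k,2)`. -/
noncomputable def Gamma (n k kb : ℕ) (z : ℕ) : ℝ :=
  if z = k ∧ kb = k then (k.choose 2 : ℝ)
  else (z.choose 2 : ℝ) +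
    binEntInv (Real.log 2 -
        Real.log ((k.choose z : ℝ) * ((n - k).choose (kb - z) : ℝ)) /
          ((kb.choose 2 : ℝ) - (z.choose 2 : ℝ))) *
      ((kb.choose 2 : ℝ) - (z.choose 2 : ℝ))

/-- The discretized interval `I = ℤ ∩ [⌊C₀·k̄k/n⌋, (1−ε)k]`, as a set of naturals. -/
def Iset (n k kb : ℕ) (C₀ ε : ℝ) : Set ℕ :=
  {z : ℕ | ⌊C₀ * (kb : ℝ) * (k : ℝ) / (n : ℝ)⌋₊ ≤ z ∧ (z : ℝ) ≤ (1 - ε) * (k : ℝ)}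

lemma binEnt_le_tangent {a b : ℝ} (ha : 0 < a) (ha1 : a < 1) (hb : 0 ≤ b) (hb1 : b ≤ 1) :
    binEnt b ≤ binEnt a + (Real.log (1 - a) - Real.log a) * (b - a) := by
  have key : ∀ {c d : ℝ}, 0 < c → 0 ≤ d → d * Real.log c - d * Real.log d ≤ c - d := by
    intro c d hc hd
    rcases hd.eq_or_lt with rfl | hd
    · simpa using hc.le
    · have h := Real.log_le_sub_one_of_pos (div_pos hc hd)
      rw [Real.log_div hc.ne' hd.ne'] at h
      have h2 := mul_le_mul_of_nonneg_left h hd.le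
      have h3 : d * (c / d - 1) = c - d := by field_simp
      linarith
  have h1 := key ha hb
  have h2 := key (sub_pos.2 ha1) (sub_nonneg.2 hb1)
  unfold binEnt
  linarith

lemma binEnt_half : binEnt (1 / 2) = Real.log 2 := by
  have h : (1 : ℝ) / 2 = 2⁻¹ := by norm_num
  have h' : (1 : ℝ) - 2⁻¹ = 2⁻¹ := by norm_num
  rw [binEnt, h, h', Real.log_inv]
  ring

lemma log_odds_lower {a : ℝ} (ha : 1 / 2 ≤ a) (ha1 : a < 1) :
    2 * (a - 1 / 2) ≤ Real.log a - Real.log (1 - a) := by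
  have h0 : 0 < a := by linarith
  have h := Real.log_le_sub_one_of_pos (div_pos (sub_pos.2 ha1) h0)
  rw [Real.log_div (sub_pos.2 ha1).ne' h0.ne'] at h
  have h2 : (1 - a) / a - 1 ≤ - (2 * (a - 1 / 2)) := by
    rw [div_sub_one h0.ne', div_le_iff₀ h0]
    nlinarith
  linarith

lemma log_odds_upper {a : ℝ} (ha : 1 / 2 ≤ a) (ha1 : a ≤ 3 / 4) :
    Real.log a - Real.log (1 - a) ≤ 8 * (a - 1 / 2) := by
  have h0 : 0 < a := by linarith
  have h1 : 0 < 1 - a := by linarith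
  have h := Real.log_le_sub_one_of_pos (div_pos h0 h1)
  rw [Real.log_div h0.ne' h1.ne'] at h
  have h2 : a / (1 - a) - 1 ≤ 8 * (a - 1 / 2) := by
    rw [div_sub_one h1.ne', div_le_iff₀ h1]
    nlinarith
  linarith

lemma sq_le_log_two_sub_binEnt {a : ℝ} (ha : 1 / 2 ≤ a) (ha1 : a ≤ 1) :
    (a - 1 / 2) ^ 2 / 2 ≤ Real.log 2 - binEnt a := by
  have hm : (1 : ℝ) / 2 ≤ (a + 1 / 2) / 2 := by linarith
  have hm1 : (a + 1 / 2) / 2 < 1 := by linarith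
  have hm0 : 0 < (a + 1 / 2) / 2 := by linarith
  have t1 := binEnt_le_tangent hm0 hm1 (by linarith : 0 ≤ a) ha1
  have t2 := binEnt_le_tangent (a := 1 / 2) (by norm_num) (by norm_num) hm0.le hm1.le
  rw [binEnt_half] at t2
  norm_num at t2
  nlinarith [mul_le_mul_of_nonneg_right (log_odds_lower hm hm1)
    (by linarith : 0 ≤ a - (a + 1 / 2) / 2)]

lemma log_two_sub_binEnt_le {a : ℝ} (ha : 1 / 2 ≤ a) (ha1 : a < 1) :
    Real.log 2 - binEnt a ≤ (Real.log a - Real.log (1 - a)) * (a - 1 / 2) := by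
  have t := binEnt_le_tangent (b := 1 / 2) (by linarith : 0 < a) ha1 (by norm_num) (by norm_num)
  rw [binEnt_half] at t
  linarith

lemma exists_binEnt_eq {x : ℝ} (hx : 0 ≤ x) (hx1 : x ≤ Real.log 2) :
    ∃ y ∈ Set.Icc (1 / 2 : ℝ) 1, binEnt y = x := by
  have hc : ContinuousOn binEnt (Set.Icc (1 / 2 : ℝ) 1) := by
    have : binEnt = Real.binEntropy := by
      ext y
      rw [binEnt, Real.binEntropy, Real.log_inv, Real.log_inv]
      ring
    rw [this]
    exact Real.binEntropy_continuous.continuousOn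
  have h := intermediate_value_Icc' (by norm_num : (1 / 2 : ℝ) ≤ 1) hc
  apply h
  rw [binEnt_half]
  exact ⟨by simpa [binEnt] using hx, hx1⟩

lemma binEntInv_spec {x : ℝ} (hx : 0 ≤ x) (hx1 : x ≤ Real.log 2) :
    1 / 2 ≤ binEntInv (Real.log 2 - x) ∧ binEntInv (Real.log 2 - x) ≤ 1 ∧
      Real.log 2 - binEnt (binEntInv (Real.log 2 - x)) = x := by
  have h := exists_binEnt_eq (x := Real.log 2 - x) (by linarith) (by linarith)
  have h1 := Function.invFunOn_mem h
  have h2 := Function.invFunOn_eq h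
  refine ⟨h1.1, h1.2, ?_⟩
  unfold binEntInv
  rw [h2]
  ring

/-- Bounds on `y` and on the log-odds at `y` when `log 2 - h(y)` is a small positive number. -/
lemma log_odds_bounds {y x : ℝ} (hy : 1 / 2 ≤ y) (hy1 : y ≤ 1)
    (h : Real.log 2 - binEnt y = x) (hx : 0 < x) (hx1 : x ≤ 1 / 32) :
    1 / 2 < y ∧ y ≤ 3 / 4 ∧ (y - 1 / 2) ^ 2 ≤ 2 * x ∧ x ≤ 8 * (y - 1 / 2) ^ 2 ∧
      2 * (y - 1 / 2) ≤ Real.log y - Real.log (1 - y) ∧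
      Real.log y - Real.log (1 - y) ≤ 8 * (y - 1 / 2) := by
  have h1 := sq_le_log_two_sub_binEnt hy hy1
  have h2 : y ≤ 3 / 4 := by nlinarith
  have h3 := log_two_sub_binEnt_le hy (by linarith)
  have h4 := log_odds_upper hy h2
  refine ⟨lt_of_le_of_ne hy ?_, h2, by linarith, by nlinarith,
    log_odds_lower hy (by linarith), h4⟩
  rintro rfl
  rw [binEnt_half] at h
  linarith

lemma perspective_increment_pos {M z L L' y y' B : ℝ} (hz : 0 ≤ z) (hM : 0 < M - z)
    (hy : 1 / 2 ≤ y) (hy1 : y ≤ 1) (hy' : 1 / 2 ≤ y') (hy1' : y' ≤ 1)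
    (h : Real.log 2 - binEnt y = L / M) (h' : Real.log 2 - binEnt y' = L' / (M - z))
    (hL' : 0 < L') (hx' : L' / (M - z) ≤ 1 / 32) (hB : L - L' ≤ B)
    (hlarge : 32 * B ^ 2 * (M - z) < z ^ 2 * L') :
    M * y < z + (M - z) * y' := by
  obtain ⟨b1, b2, -, b4, b5, -⟩ := log_odds_bounds hy' hy1' h' (div_pos hL' hM) hx'
  set s := Real.log y' - Real.log (1 - y') with hs
  have hs0 : 0 < s := by linarith
  have hM0 : 0 < M := by linarith
  have t := binEnt_le_tangent (a := y') (b := y) (by linarith) (by linarith) (by linarith) hy1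
  have t' : L' / (M - z) + s * (y - y') ≤ L / M := by rw [← h, ← h', hs]; linarith
  have e1 : M * (L / M) = L := by field_simp
  have e2 : M * (L' / (M - z)) = L' + z * (L' / (M - z)) := by field_simp; ring
  have t2 := mul_le_mul_of_nonneg_left t' hM0.le
  rw [mul_add, e1, e2] at t2
  have hzx : 0 ≤ z * (L' / (M - z)) := mul_nonneg hz (div_pos hL' hM).le
  have hBz : 2 * B < (y' - 1 / 2) * z := by
    apply lt_of_pow_lt_pow_left₀ 2 (mul_nonneg (by linarith) hz)
    have hq : 32 * B ^ 2 < z ^ 2 * (L' / (M - z)) := by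
      rw [← mul_div_assoc, lt_div_iff₀ hM]; exact hlarge
    nlinarith [mul_le_mul_of_nonneg_left b4 (sq_nonneg z)]
  have hfin : 0 < s * (z + (M - z) * y' - M * y) := by
    have e3 : s * (z + (M - z) * y' - M * y) = s * z * (1 - y') - M * (s * (y - y')) := by ring
    have e4 : 2 * (y' - 1 / 2) * z ≤ s * z := mul_le_mul_of_nonneg_right b5 hz
    have e5 : s * z * (1 / 4) ≤ s * z * (1 - y') :=
      mul_le_mul_of_nonneg_left (by linarith) (mul_nonneg hs0.le hz)
    rw [e3]
    linarith
  linarith [pos_of_mul_pos_right hfin hs0.le]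

lemma perspective_increment_neg {M z L L' y y' : ℝ} (hz : 0 ≤ z) (hM : 0 < M - z)
    (hy : 1 / 2 ≤ y) (hy1 : y ≤ 1) (hy' : 1 / 2 ≤ y') (hy1' : y' ≤ 1)
    (h : Real.log 2 - binEnt y = L / M) (h' : Real.log 2 - binEnt y' = L' / (M - z))
    (hL : 0 < L) (hx : L / M ≤ 1 / 32) (hLL : L' ≤ L - 1) (hsmall : 32 * z ^ 2 * L < M) :
    z + (M - z) * y' < M * y := by
  have hM0 : 0 < M := by linarith
  obtain ⟨b1, b2, b3, -, b5, b6⟩ := log_odds_bounds hy hy1 h (div_pos hL hM0) hx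
  have hxs := log_two_sub_binEnt_le hy (by linarith)
  set s := Real.log y - Real.log (1 - y) with hs
  have hs0 : 0 < s := by linarith
  have t := binEnt_le_tangent (a := y) (b := y') (by linarith) (by linarith) (by linarith) hy1'
  have t' : L / M + s * (y' - y) ≤ L' / (M - z) := by rw [← h, ← h', hs]; linarith
  have e1 : (M - z) * (L' / (M - z)) = L' := by field_simp
  have e2 : (M - z) * (L / M) = L - z * (L / M) := by field_simp
  have t2 := mul_le_mul_of_nonneg_left t' hM.le
  rw [mul_add, e1, e2] at t2
  rw [h] at hxs
  have hzx := mul_le_mul_of_nonneg_left hxs hz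
  have hzd : (y - 1 / 2) * z < 1 / 4 := by
    apply lt_of_pow_lt_pow_left₀ 2 (by norm_num)
    have hq : 32 * z ^ 2 * (L / M) < 1 := by
      rw [← mul_div_assoc, div_lt_one hM0]; exact hsmall
    nlinarith [mul_le_mul_of_nonneg_left b3 (sq_nonneg z)]
  have hfin : s * (z + (M - z) * y' - M * y) < 0 := by
    have e3 : s * (z + (M - z) * y' - M * y)
      = s * z * (1 - y) + (M - z) * (s * (y' - y)) := by ring
    have e4 : s * z ≤ 8 * (y - 1 / 2) * z := mul_le_mul_of_nonneg_right b6 hz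
    rw [e3]
    linarith
  linarith [neg_of_mul_neg_right hfin hs0.le]

/-- Size conditions on `(n, k, k̄)` under which the entropy deficit in `Gamma` is small. -/
structure SparseRegime (ε : ℝ) (n k kb : ℕ) : Prop where
  k_le : k ≤ kb
  kb_le : 4 * kb ≤ n
  two_le : 2 ≤ kb
  k_pos : 0 < k
  log_le : 256 * Real.log ((n : ℝ) / kb) ≤ ε * kb

/-- The number of `kb`-subsets of `Fin n` meeting a fixed `k`-subset in exactly `z` points. -/
def overlapCount (n k kb z : ℕ) : ℝ := (k.choose z : ℝ) * ((n - k).choose (kb - z) : ℝ)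

/-- The number of pairs inside a `kb`-set which are not inside a fixed `z`-subset. -/
def freePairs (kb z : ℕ) : ℝ := (kb.choose 2 : ℝ) - (z.choose 2 : ℝ)

lemma freePairs_eq (kb z : ℕ) :
    freePairs kb z = ((kb : ℝ) * (kb - 1) - (z : ℝ) * (z - 1)) / 2 := by
  rw [freePairs, Nat.cast_choose_two, Nat.cast_choose_two]
  ring

lemma freePairs_succ (kb z : ℕ) : freePairs kb (z + 1) = freePairs kb z - z := by
  rw [freePairs_eq, freePairs_eq]
  push_cast
  ring

lemma freePairs_le (kb z : ℕ) : freePairs kb z ≤ (kb : ℝ) ^ 2 / 2 := by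
  have h : (0 : ℝ) ≤ (z.choose 2 : ℝ) := by positivity
  rw [freePairs, Nat.cast_choose_two]
  have : (0 : ℝ) ≤ (kb : ℝ) := by positivity
  linarith

section

variable {ε : ℝ} {n k kb z : ℕ}

lemma SparseRegime.kb_pos (H : SparseRegime ε n k kb) : (0 : ℝ) < kb := by
  exact_mod_cast lt_of_lt_of_le (by norm_num) H.two_le

lemma SparseRegime.four_le_div (H : SparseRegime ε n k kb) : (4 : ℝ) ≤ (n : ℝ) / kb := by
  rw [le_div_iff₀ H.kb_pos]
  exact_mod_cast H.kb_le

lemma SparseRegime.one_le_log (H : SparseRegime ε n k kb) :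
    1 ≤ Real.log ((n : ℝ) / kb) := by
  rw [Real.le_log_iff_exp_le (by linarith [H.four_le_div])]
  linarith [H.four_le_div, Real.exp_one_lt_d9]

lemma SparseRegime.lt_of_le (H : SparseRegime ε n k kb) (hε : 0 < ε)
    (hz : (z : ℝ) ≤ (1 - ε) * k) : z < k := by
  have hk : (0 : ℝ) < k := by exact_mod_cast H.k_pos
  have : (z : ℝ) < k := by nlinarith
  exact_mod_cast this

lemma SparseRegime.le_sub (H : SparseRegime ε n k kb) (hε1 : ε < 1)
    (hz : (z : ℝ) ≤ (1 - ε) * k) : ε * kb ≤ kb - z := by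
  have hk : (k : ℝ) ≤ kb := by exact_mod_cast H.k_le
  nlinarith

lemma SparseRegime.le_freePairs (H : SparseRegime ε n k kb) (hε : 0 < ε) (hε1 : ε < 1)
    (hz : (z : ℝ) ≤ (1 - ε) * k) : ε * (kb : ℝ) ^ 2 / 4 ≤ freePairs kb z := by
  have h1 := H.le_sub hε1 hz
  have h2 : (2 : ℝ) ≤ kb := by exact_mod_cast H.two_le
  have h3 : (0 : ℝ) ≤ z := by positivity
  have e : freePairs kb z = ((kb : ℝ) - z) * (kb + z - 1) / 2 := by rw [freePairs_eq]; ring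
  have h4 : (kb : ℝ) / 2 ≤ kb + z - 1 := by linarith
  have h5 : 0 ≤ ε * (kb : ℝ) := by positivity
  have := mul_le_mul h1 h4 (by linarith) (by linarith)
  rw [e]
  linarith

lemma overlapCount_pos (H : SparseRegime ε n k kb) (hz : z ≤ k) : 0 < overlapCount n k kb z := by
  have := H.kb_le
  have := H.k_le
  exact mul_pos (by exact_mod_cast Nat.choose_pos hz)
    (by exact_mod_cast Nat.choose_pos (by omega))

lemma overlapCount_succ_mul (H : SparseRegime ε n k kb) (hz : z < k) :
    overlapCount n k kb (z + 1) * (((z : ℝ) + 1) * ((n : ℝ) - k - kb + z + 1)) =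
      overlapCount n k kb z * (((k : ℝ) - z) * (kb - z)) := by
  have h4 := H.kb_le
  have hk := H.k_le
  have a := Nat.choose_succ_right_eq k z
  have b := Nat.choose_succ_right_eq (n - k) (kb - (z + 1))
  have e : kb - (z + 1) + 1 = kb - z := by omega
  have e' : n - k - (kb - (z + 1)) = n + z + 1 - k - kb := by omega
  rw [e, e'] at b
  have a' : (k.choose (z + 1) : ℝ) * (z + 1) = k.choose z * ((k : ℝ) - z) := by
    have := congrArg (Nat.cast (R := ℝ)) a
    push_cast [Nat.cast_sub hz.le] at this
    exact this
  have b' : ((n - k).choose (kb - z) : ℝ) * ((kb : ℝ) - z) =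
      (n - k).choose (kb - (z + 1)) * ((n : ℝ) - k - kb + z + 1) := by
    have := congrArg (Nat.cast (R := ℝ)) b
    rw [Nat.sub_sub] at this
    push_cast [Nat.cast_sub (hz.le.trans hk), Nat.cast_sub (by omega : k + kb ≤ n + z + 1)] at this
    rw [this]
    ring
  unfold overlapCount
  calc _ = ((k.choose (z + 1) : ℝ) * (z + 1)) *
        ((n - k).choose (kb - (z + 1)) * ((n : ℝ) - k - kb + z + 1)) := by ring
    _ = _ := by rw [a', ← b']; ring

lemma log_overlapCount_le (H : SparseRegime ε n k kb) (hz : z ≤ k) :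
    Real.log (overlapCount n k kb z) ≤ 2 * kb * Real.log ((n : ℝ) / kb) := by
  have h4 := H.kb_le
  have hk := H.k_le
  have hkb := H.kb_pos
  have hn : (0 : ℝ) < n := by
    have := H.two_le
    exact_mod_cast (by omega : 0 < n)
  have h1 : k.choose z * (n - k).choose (kb - z) ≤ n.choose kb := by
    have := Nat.add_choose_eq k (n - k) kb
    rw [Nat.add_sub_cancel' (by omega : k ≤ n)] at this
    rw [this]
    exact Finset.single_le_sum (f := fun ij : ℕ × ℕ => k.choose ij.1 * (n - k).choose ij.2)
      (fun _ _ => Nat.zero_le _) (a := (z, kb - z))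
      (Finset.HasAntidiagonal.mem_antidiagonal.2 (Nat.add_sub_cancel' (hz.trans hk)))
  have h2 : overlapCount n k kb z ≤ ((n : ℝ) / kb) ^ kb * Real.exp kb := by
    have h3 : overlapCount n k kb z ≤ (n.choose kb : ℝ) := by
      unfold overlapCount
      exact_mod_cast h1
    have h5 := Nat.choose_le_pow_div (α := ℝ) kb n
    have h6 := Real.pow_div_factorial_le_exp (kb : ℝ) hkb.le kb
    calc _ ≤ _ := h3.trans h5
      _ = ((n : ℝ) / kb) ^ kb * ((kb : ℝ) ^ kb / kb.factorial) := by
        rw [div_pow]; field_simp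
      _ ≤ _ := by gcongr
  have h7 := Real.log_le_log (overlapCount_pos H hz) h2
  rw [Real.log_mul (by positivity) (by positivity), Real.log_exp, Real.log_pow] at h7
  nlinarith [H.one_le_log]

lemma le_log_overlapCount (H : SparseRegime ε n k kb) (hε : 0 < ε) (hε1 : ε < 1)
    (hz : (z : ℝ) ≤ (1 - ε) * k) :
    ε / 2 * kb * Real.log ((n : ℝ) / kb) ≤ Real.log (overlapCount n k kb z) := by
  have hzk := H.lt_of_le hε hz
  have h4 := H.kb_le
  have hk := H.k_le
  have hkb := H.kb_pos
  have hs := H.four_le_div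
  set r := kb - z with hr
  have hr0 : 0 < r := by omega
  have hrr : (r : ℝ) = kb - z := by rw [hr, Nat.cast_sub (by omega)]
  have h1 : ((n : ℝ) / kb / 2) ^ r ≤ overlapCount n k kb z := by
    have c1 : (1 : ℝ) ≤ (k.choose z : ℝ) := by exact_mod_cast Nat.choose_pos hzk.le
    have c2 := Nat.pow_le_choose (α := ℝ) r (n - k)
    have c3 : (r.factorial : ℝ) ≤ (kb : ℝ) ^ r := by
      have : r.factorial ≤ kb ^ r :=
        (Nat.factorial_le_pow r).trans (Nat.pow_le_pow_left (by omega) r)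
      exact_mod_cast this
    have c4 : (n : ℝ) / 2 ≤ ((n - k + 1 - r : ℕ) : ℝ) := by
      have : n ≤ 2 * (n - k + 1 - r) := by omega
      have : (n : ℝ) ≤ 2 * ((n - k + 1 - r : ℕ) : ℝ) := by exact_mod_cast this
      linarith
    calc ((n : ℝ) / kb / 2) ^ r = ((n : ℝ) / 2) ^ r / (kb : ℝ) ^ r := by
          rw [← div_pow]; congr 1; ring
      _ ≤ ((n - k + 1 - r : ℕ) : ℝ) ^ r / r.factorial := by gcongr
      _ ≤ ((n - k).choose r : ℝ) := c2
      _ ≤ _ := by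
        unfold overlapCount
        exact le_mul_of_one_le_left (by positivity) c1
  have h2 := Real.log_le_log (by positivity) h1
  rw [Real.log_pow] at h2
  have h3 : Real.log ((n : ℝ) / kb) / 2 ≤ Real.log ((n : ℝ) / kb / 2) := by
    have h5 : (n : ℝ) / kb ≤ ((n : ℝ) / kb / 2) ^ 2 := by nlinarith
    have h6 := Real.log_le_log (by linarith) h5
    rw [Real.log_pow] at h6
    push_cast at h6
    linarith
  have h8 := H.le_sub hε1 hz
  rw [← hrr] at h8
  have h9 := mul_le_mul h8 h3 (by linarith [H.one_le_log]) (by positivity)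
  linarith

lemma entropy_deficit_bounds (H : SparseRegime ε n k kb) (hε : 0 < ε) (hε1 : ε < 1)
    (hz : (z : ℝ) ≤ (1 - ε) * k) :
    0 < Real.log (overlapCount n k kb z) ∧ 0 < freePairs kb z ∧
      Real.log (overlapCount n k kb z) / freePairs kb z ≤ 1 / 32 := by
  have hkb := H.kb_pos
  have h1 := le_log_overlapCount H hε hε1 hz
  have h2 := log_overlapCount_le H (H.lt_of_le hε hz).le
  have h3 := H.le_freePairs hε hε1 hz
  have hM : 0 < freePairs kb z := lt_of_lt_of_le (by positivity) h3
  have hs : 0 < Real.log ((n : ℝ) / kb) := by linarith [H.one_le_log]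
  refine ⟨lt_of_lt_of_le (by positivity) h1, hM, ?_⟩
  rw [div_le_iff₀ hM]
  nlinarith [mul_le_mul_of_nonneg_right H.log_le hkb.le]

/-- The factor by which `Gamma` weights the pairs counted by `freePairs`. -/
def freeDensity (n k kb z : ℕ) : ℝ :=
  binEntInv (Real.log 2 - Real.log (overlapCount n k kb z) / freePairs kb z)

lemma freeDensity_spec (H : SparseRegime ε n k kb) (hε : 0 < ε) (hε1 : ε < 1)
    (hz : (z : ℝ) ≤ (1 - ε) * k) :
    1 / 2 ≤ freeDensity n k kb z ∧ freeDensity n k kb z ≤ 1 ∧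
      Real.log 2 - binEnt (freeDensity n k kb z) =
        Real.log (overlapCount n k kb z) / freePairs kb z := by
  obtain ⟨h1, h2, h3⟩ := entropy_deficit_bounds H hε hε1 hz
  exact binEntInv_spec (div_pos h1 h2).le (by linarith [Real.log_two_gt_d9])

lemma Gamma_eq (hz : z < k) :
    Gamma n k kb z = (z.choose 2 : ℝ) + freeDensity n k kb z * freePairs kb z := by
  rw [Gamma, if_neg (fun h => hz.ne h.1)]
  rfl

lemma Gamma_succ_eq (hz : z + 1 < k) :
    Gamma n k kb (z + 1) = (z.choose 2 : ℝ) +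
      (z + (freePairs kb z - z) * freeDensity n k kb (z + 1)) := by
  rw [Gamma_eq hz, freePairs_succ, Nat.choose_succ_succ' z 1]
  push_cast [Nat.choose_one_right]
  ring

lemma Gamma_lt_succ (H : SparseRegime ε n k kb) (hε : 0 < ε) (hε1 : ε < 1) (hz0 : 1 ≤ z)
    (hz : (z : ℝ) + 1 ≤ (1 - ε) * k)
    (hlarge : 256 / ε ^ 3 < z * k * Real.log ((n : ℝ) / kb) / n) :
    Gamma n k kb z < Gamma n k kb (z + 1) := by
  have hz' : ((z + 1 : ℕ) : ℝ) ≤ (1 - ε) * k := by exact_mod_cast hz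
  have hzz : (z : ℝ) ≤ (1 - ε) * k := by linarith
  have hzk := H.lt_of_le hε hz'
  have hkb := H.kb_pos
  have hk : (0 : ℝ) < k := by exact_mod_cast H.k_pos
  have hn : (0 : ℝ) < n := by
    have := H.two_le; have := H.kb_le
    exact_mod_cast (by omega : 0 < n)
  have hz1 : (1 : ℝ) ≤ z := by exact_mod_cast hz0
  have hl := H.one_le_log
  obtain ⟨hL, hM, -⟩ := entropy_deficit_bounds H hε hε1 hzz
  obtain ⟨hL', hM', hx'⟩ := entropy_deficit_bounds H hε hε1 hz'
  obtain ⟨y1, y2, y3⟩ := freeDensity_spec H hε hε1 hzz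
  obtain ⟨y1', y2', y3'⟩ := freeDensity_spec H hε hε1 hz'
  rw [freePairs_succ] at hM' hx' y3'
  set u : ℝ := 2 * z * n / (ε ^ 2 * k * kb) with hu
  have hu0 : 0 < u := by positivity
  have hratio : overlapCount n k kb z ≤ overlapCount n k kb (z + 1) * u := by
    have e := overlapCount_succ_mul H (by omega : z < k)
    have p := overlapCount_pos H hzk.le
    have q1 : ε * (k : ℝ) ≤ k - z := by linarith
    have q2 := H.le_sub hε1 hzz
    have q3 : (kb : ℝ) ≥ z + 1 := by exact_mod_cast hzk.le.trans H.k_le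
    have q4 : (n : ℝ) - k - kb + z + 1 ≤ n := by linarith
    have q5 : 0 ≤ (n : ℝ) - k - kb + z + 1 := by
      have : (k : ℝ) ≤ kb := by exact_mod_cast H.k_le
      have : 4 * (kb : ℝ) ≤ n := by exact_mod_cast H.kb_le
      linarith
    have q6 : ((z : ℝ) + 1) * ((n : ℝ) - k - kb + z + 1) ≤ 2 * z * n :=
      mul_le_mul (by linarith) q4 q5 (by linarith)
    have q7 : (ε * k) * (ε * kb) ≤ ((k : ℝ) - z) * (kb - z) :=
      mul_le_mul q1 q2 (by positivity) (by nlinarith)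
    rw [hu, ← mul_div_assoc, le_div_iff₀ (by positivity)]
    calc overlapCount n k kb z * (ε ^ 2 * k * kb)
        = overlapCount n k kb z * ((ε * k) * (ε * kb)) := by ring
      _ ≤ overlapCount n k kb z * (((k : ℝ) - z) * (kb - z)) :=
        mul_le_mul_of_nonneg_left q7 (overlapCount_pos H (by omega)).le
      _ = _ := e.symm
      _ ≤ _ := mul_le_mul_of_nonneg_left q6 p.le
  have hlog : Real.log (overlapCount n k kb z) - Real.log (overlapCount n k kb (z + 1)) ≤
      2 * Real.sqrt u := by
    have p := overlapCount_pos H hzk.le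
    have h1 := Real.log_le_log (overlapCount_pos H (by omega : z ≤ k)) hratio
    rw [Real.log_mul p.ne' hu0.ne'] at h1
    have h2 := Real.log_le_sub_one_of_pos (Real.sqrt_pos.2 hu0)
    rw [Real.log_sqrt hu0.le] at h2
    linarith
  have main := perspective_increment_pos (by linarith : (0 : ℝ) ≤ z) hM' y1 y2 y1' y2' y3 y3'
    hL' hx' hlog (by
      rw [mul_pow, Real.sq_sqrt hu0.le]
      have hMu := freePairs_le kb z
      have hlow := le_log_overlapCount H hε hε1 hz'
      have hl2 : 256 * n < z * k * Real.log ((n : ℝ) / kb) * ε ^ 3 := by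
        rwa [div_lt_div_iff₀ (by positivity) hn] at hlarge
      calc 32 * (2 ^ 2 * u) * (freePairs kb z - z) ≤ 32 * (2 ^ 2 * u) * ((kb : ℝ) ^ 2 / 2) := by
            gcongr
            linarith
        _ = 256 * n * (z * kb / (2 * ε ^ 2 * k) ) := by
            rw [hu]; field_simp; ring
        _ < z * k * Real.log ((n : ℝ) / kb) * ε ^ 3 * (z * kb / (2 * ε ^ 2 * k)) := by
            gcongr
        _ = (z : ℝ) ^ 2 * (ε / 2 * kb * Real.log ((n : ℝ) / kb)) := by
            field_simp
        _ ≤ _ := by gcongr)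
  rw [Gamma_eq (by omega), Gamma_succ_eq hzk]
  linarith

lemma Gamma_succ_lt (H : SparseRegime ε n k kb) (hε : 0 < ε) (hε1 : ε < 1)
    (hz : (z : ℝ) + 1 ≤ (1 - ε) * k) (hlow : 6 * kb * k / n ≤ (z : ℝ) + 1)
    (hsmall : 256 * (z : ℝ) ^ 2 * Real.log ((n : ℝ) / kb) < ε * kb) :
    Gamma n k kb (z + 1) < Gamma n k kb z := by
  have hz' : ((z + 1 : ℕ) : ℝ) ≤ (1 - ε) * k := by exact_mod_cast hz
  have hzz : (z : ℝ) ≤ (1 - ε) * k := by linarith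
  have hzk := H.lt_of_le hε hz'
  have hkb := H.kb_pos
  have hk : (0 : ℝ) < k := by exact_mod_cast H.k_pos
  have hn : (0 : ℝ) < n := by
    have := H.two_le; have := H.kb_le
    exact_mod_cast (by omega : 0 < n)
  have hz0 : (0 : ℝ) ≤ z := by positivity
  obtain ⟨hL, hM, hx⟩ := entropy_deficit_bounds H hε hε1 hzz
  obtain ⟨hL', hM', -⟩ := entropy_deficit_bounds H hε hε1 hz'
  obtain ⟨y1, y2, y3⟩ := freeDensity_spec H hε hε1 hzz
  obtain ⟨y1', y2', y3'⟩ := freeDensity_spec H hε hε1 hz'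
  rw [freePairs_succ] at hM' y3'
  have hratio : overlapCount n k kb (z + 1) * Real.exp 1 ≤ overlapCount n k kb z := by
    have e := overlapCount_succ_mul H (by omega : z < k)
    have q0 : (z : ℝ) + 1 ≤ k := by exact_mod_cast hzk.le
    have q1 : (k : ℝ) ≤ kb := by exact_mod_cast H.k_le
    have q2 : 4 * (kb : ℝ) ≤ n := by exact_mod_cast H.kb_le
    have q3 : (k : ℝ) * kb * 3 ≤ ((z : ℝ) + 1) * ((n : ℝ) - k - kb + z + 1) := by
      rw [div_le_iff₀ hn] at hlow
      have : (n : ℝ) / 2 ≤ (n : ℝ) - k - kb + z + 1 := by linarith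
      have := mul_le_mul_of_nonneg_left this (by linarith : (0 : ℝ) ≤ z + 1)
      linarith
    have q4 : ((k : ℝ) - z) * (kb - z) ≤ k * kb :=
      mul_le_mul (by linarith) (by linarith) (by linarith) hk.le
    have p := overlapCount_pos H hzk.le
    have p' := overlapCount_pos H (by omega : z ≤ k)
    have q5 : overlapCount n k kb (z + 1) * 3 * (k * kb) ≤ overlapCount n k kb z * (k * kb) := by
      calc _ = overlapCount n k kb (z + 1) * (k * kb * 3) := by ring
        _ ≤ _ := mul_le_mul_of_nonneg_left q3 p.le
        _ = _ := e
        _ ≤ _ := mul_le_mul_of_nonneg_left q4 p'.le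
    have q6 := le_of_mul_le_mul_right q5 (by positivity)
    have q7 : Real.exp 1 ≤ 3 := by linarith [Real.exp_one_lt_d9]
    exact (mul_le_mul_of_nonneg_left q7 p.le).trans q6
  have hlog : Real.log (overlapCount n k kb (z + 1)) ≤ Real.log (overlapCount n k kb z) - 1 := by
    have p := overlapCount_pos H hzk.le
    have h1 := Real.log_le_log (by positivity) hratio
    rw [Real.log_mul p.ne' (Real.exp_pos 1).ne', Real.log_exp] at h1
    linarith
  have main := perspective_increment_neg hz0 hM' y1 y2 y1' y2' y3 y3' hL hx hlog (by
      have hlow := H.le_freePairs hε hε1 hzz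
      have hup := log_overlapCount_le H (by omega : z ≤ k)
      calc 32 * (z : ℝ) ^ 2 * Real.log (overlapCount n k kb z)
          ≤ 32 * (z : ℝ) ^ 2 * (2 * kb * Real.log ((n : ℝ) / kb)) := by gcongr
        _ = 256 * (z : ℝ) ^ 2 * Real.log ((n : ℝ) / kb) * (kb / 4) := by ring
        _ < ε * kb * (kb / 4) := by gcongr
        _ = ε * (kb : ℝ) ^ 2 / 4 := by ring
        _ ≤ _ := hlow)
  rw [Gamma_succ_eq hzk, Gamma_eq (by omega)]
  linarith

end

section Asymptotics

lemma tendsto_mul_log_div_atTop {t s : ℕ → ℝ} (ht : Tendsto t atTop atTop)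
    (hs : Tendsto s atTop atTop)
    (h : Tendsto (fun n => t n * Real.log (t n) / s n) atTop atTop) :
    Tendsto (fun n => t n * Real.log (s n) / s n) atTop atTop := by
  have hsqrt : Tendsto (fun n => Real.sqrt (t n)) atTop atTop :=
    Real.tendsto_sqrt_atTop.comp ht
  have hmin := tendsto_atTop_mono' atTop (f₁ := fun n =>
    min (t n * Real.log (t n) / s n / 2) (Real.sqrt (t n)))
    (f₂ := fun n => t n * Real.log (s n) / s n) ?_ ?_
  · exact hmin
  · filter_upwards [ht.eventually_ge_atTop 1, hs.eventually_ge_atTop (Real.exp 1)] with n h1 h2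
    have hs0 : 0 < s n := (Real.exp_pos 1).trans_le h2
    have hl : 1 ≤ Real.log (s n) := (Real.le_log_iff_exp_le hs0).2 h2
    have ht0 : 0 < t n := by linarith
    rcases le_total (Real.sqrt (t n)) (s n) with hc | hc
    · refine (min_le_left _ _).trans ?_
      have := Real.log_le_log (Real.sqrt_pos.2 ht0) hc
      rw [Real.log_sqrt ht0.le] at this
      calc t n * Real.log (t n) / s n / 2 = t n * (Real.log (t n) / 2) / s n := by ring
        _ ≤ _ := by gcongr
    · refine (min_le_right _ _).trans ?_
      rw [le_div_iff₀ hs0]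
      nlinarith [Real.mul_self_sqrt ht0.le, Real.sqrt_nonneg (t n)]
  · rw [tendsto_atTop]
    intro b
    filter_upwards [h.eventually_ge_atTop (2 * b), hsqrt.eventually_ge_atTop b] with n h1 h2
    exact le_min (by linarith) h2

lemma tendsto_mul_log_div_zero {t s : ℕ → ℝ} (ht : Tendsto t atTop atTop)
    (hs : Tendsto s atTop atTop)
    (h : Tendsto (fun n => t n * Real.log (t n) / s n) atTop (nhds 0)) :
    Tendsto (fun n => t n * Real.log (s n) / s n) atTop (nhds 0) := by
  have hlog : Tendsto (fun n => Real.log (s n) / Real.sqrt (s n)) atTop (nhds 0) := by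
    have := (isLittleO_log_rpow_atTop (by norm_num : (0 : ℝ) < 1 / 2)).tendsto_div_nhds_zero.comp hs
    simpa only [Function.comp_def, ← Real.sqrt_eq_rpow] using this
  have hmax : Tendsto (fun n => 2 * (t n * Real.log (t n) / s n) +
      Real.log (s n) / Real.sqrt (s n)) atTop (nhds 0) := by
    simpa using (h.const_mul 2).add hlog
  refine squeeze_zero' ?_ ?_ hmax
  · filter_upwards [ht.eventually_ge_atTop 1, hs.eventually_ge_atTop 1] with n h1 h2
    have := Real.log_nonneg h2
    positivity
  · filter_upwards [ht.eventually_ge_atTop 1, hs.eventually_ge_atTop 1] with n h1 h2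
    have hs0 : 0 < s n := by linarith
    have hls := Real.log_nonneg h2
    have hlt := Real.log_nonneg h1
    have ht0 : 0 < t n := by linarith
    rcases le_total (Real.sqrt (s n)) (t n) with hc | hc
    · have := Real.log_le_log (Real.sqrt_pos.2 hs0) hc
      rw [Real.log_sqrt hs0.le] at this
      have h3 : 0 ≤ Real.log (s n) / Real.sqrt (s n) := by positivity
      calc t n * Real.log (s n) / s n ≤ t n * (2 * Real.log (t n)) / s n := by
            gcongr
            linarith
        _ = 2 * (t n * Real.log (t n) / s n) := by ring
        _ ≤ _ := by linarith
    · have h3 : 0 ≤ 2 * (t n * Real.log (t n) / s n) := by positivity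
      have hq : 0 < Real.sqrt (s n) := Real.sqrt_pos.2 hs0
      calc t n * Real.log (s n) / s n ≤ Real.sqrt (s n) * Real.log (s n) / s n := by gcongr
        _ = Real.log (s n) / Real.sqrt (s n) := by
          rw [div_eq_div_iff hs0.ne' hq.ne']
          linear_combination Real.log (s n) * Real.mul_self_sqrt hs0.le
        _ ≤ _ := by linarith

variable {k kb : ℕ → ℕ}

lemma tendsto_sq_div_of_tendsto_div_sqrt
    (hk : Tendsto (fun n : ℕ => (k n : ℝ) / Real.sqrt n) atTop atTop) :
    Tendsto (fun n : ℕ => (k n : ℝ) ^ 2 / n) atTop atTop := by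
  have h := (tendsto_pow_atTop (two_ne_zero)).comp hk
  refine h.congr fun n => ?_
  simp [div_pow]

lemma eventually_pos_of_tendsto_div_sqrt
    (hk : Tendsto (fun n : ℕ => (k n : ℝ) / Real.sqrt n) atTop atTop) :
    ∀ᶠ n in atTop, 0 < k n := by
  filter_upwards [hk.eventually_gt_atTop 0] with n hn
  rcases Nat.eq_zero_or_pos (k n) with h | h
  · simp [h] at hn
  · exact h

lemma tendsto_div_of_tendsto_div_zero
    (hkbn : Tendsto (fun n : ℕ => (kb n : ℝ) / (n : ℝ)) atTop (nhds 0))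
    (hle : ∀ᶠ n in atTop, k n ≤ kb n)
    (hk : Tendsto (fun n : ℕ => (k n : ℝ) / Real.sqrt n) atTop atTop) :
    Tendsto (fun n : ℕ => (n : ℝ) / kb n) atTop atTop := by
  have h : Tendsto (fun n : ℕ => (kb n : ℝ) / (n : ℝ)) atTop (nhdsWithin 0 (Set.Ioi 0)) := by
    refine tendsto_nhdsWithin_iff.2 ⟨hkbn, ?_⟩
    filter_upwards [hle, eventually_pos_of_tendsto_div_sqrt hk, eventually_gt_atTop 0]
      with n h1 h2 h3
    have : 0 < kb n := h2.trans_le h1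
    have h4 : (0 : ℝ) < kb n := by exact_mod_cast this
    have h5 : (0 : ℝ) < n := by exact_mod_cast h3
    exact div_pos h4 h5
  exact h.inv_tendsto_nhdsGT_zero.congr fun n => by simp

lemma eventually_sparseRegime {ε : ℝ} (hε : 0 < ε)
    (hord : ∀ᶠ n : ℕ in atTop, k n ≤ kb n ∧ kb n ≤ n)
    (hkb5 : ∀ᶠ n : ℕ in atTop, (Real.log n) ^ 5 ≤ (kb n : ℝ))
    (hkbn : Tendsto (fun n : ℕ => (kb n : ℝ) / (n : ℝ)) atTop (nhds 0))
    (hk : Tendsto (fun n : ℕ => (k n : ℝ) / Real.sqrt n) atTop atTop) :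
    ∀ᶠ n in atTop, SparseRegime ε n (k n) (kb n) := by
  have hlog : Tendsto (fun n : ℕ => Real.log n) atTop atTop :=
    Real.tendsto_log_atTop.comp tendsto_natCast_atTop_atTop
  filter_upwards [hord, hkb5, eventually_pos_of_tendsto_div_sqrt hk,
    hkbn.eventually_le_const (by norm_num : (0 : ℝ) < 1 / 4), eventually_gt_atTop 0,
    hlog.eventually_ge_atTop 2, hlog.eventually_ge_atTop (256 / ε)] with n h1 h2 h3 h4 h5 h6 h7
  have hn : (0 : ℝ) < n := by exact_mod_cast h5
  have hkb1 : (1 : ℝ) ≤ kb n := by exact_mod_cast h3.trans_le h1.1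
  set l := Real.log n
  have hl4 : l ≤ l ^ 4 := le_self_pow₀ (by linarith) (by norm_num)
  have hl5 : l * l ≤ l ^ 5 := by nlinarith
  refine ⟨h1.1, ?_, ?_, h3, ?_⟩
  · rw [div_le_iff₀ hn] at h4
    have : 4 * (kb n : ℝ) ≤ n := by linarith
    exact_mod_cast this
  · have : (2 : ℝ) ≤ kb n := by nlinarith
    exact_mod_cast this
  · have hle : Real.log ((n : ℝ) / kb n) ≤ l :=
      Real.log_le_log (by positivity) (div_le_self hn.le hkb1)
    rw [div_le_iff₀ hε] at h7
    calc 256 * Real.log ((n : ℝ) / kb n) ≤ 256 * l := by gcongr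
      _ ≤ (l * ε) * l := by gcongr
      _ = ε * (l * l) := by ring
      _ ≤ _ := by gcongr; linarith

end Asymptotics

/-- (Monotonicity phase transition, case `k = ω(√n)`.) -/
theorem gamma_monotonicity_large_k
    (k kb : ℕ → ℕ) (ε : ℝ) (hε : 0 < ε) (hε1 : ε < 1)
    (hord : ∀ᶠ n : ℕ in atTop, k n ≤ kb n ∧ kb n ≤ n)
    (hkb5 : ∀ᶠ n : ℕ in atTop, (Real.log n) ^ 5 ≤ (kb n : ℝ))
    (hkbn : Tendsto (fun n : ℕ => (kb n : ℝ) / (n : ℝ)) atTop (nhds 0))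
    (hklarge : Tendsto (fun n : ℕ => (k n : ℝ) / Real.sqrt n) atTop atTop) :
    ∃ C₀ : ℝ, 0 < C₀ ∧
      -- (2i) `k̄ = o(n²/(k²·log(k²/n)))`: the first moment curve is non-monotonic on `I`
      ((Tendsto (fun n : ℕ =>
            (kb n : ℝ) * (k n : ℝ) ^ 2 * Real.log ((k n : ℝ) ^ 2 / (n : ℝ)) / (n : ℝ) ^ 2)
            atTop (nhds 0) →
        ∀ᶠ n : ℕ in atTop,
          ¬ MonotoneOn (fun z : ℕ => Gamma n (k n) (kb n) z) (Iset n (k n) (kb n) C₀ ε) ∧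
          ¬ AntitoneOn (fun z : ℕ => Gamma n (k n) (kb n) z) (Iset n (k n) (kb n) C₀ ε)) ∧
      -- (2ii) `k̄ = ω(n²/(k²·log(k²/n)))`: the first moment curve is increasing on `I`
      (Tendsto (fun n : ℕ =>
            (kb n : ℝ) * (k n : ℝ) ^ 2 * Real.log ((k n : ℝ) ^ 2 / (n : ℝ)) / (n : ℝ) ^ 2)
            atTop atTop →
        ∀ᶠ n : ℕ in atTop,
          StrictMonoOn (fun z : ℕ => Gamma n (k n) (kb n) z) (Iset n (k n) (kb n) C₀ ε))) := by
  have ht := tendsto_sq_div_of_tendsto_div_sqrt hklarge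
  have hs := tendsto_div_of_tendsto_div_zero hkbn (hord.mono fun _ h => h.1) hklarge
  have hreg := eventually_sparseRegime hε hord hkb5 hkbn hklarge
  have hform : (fun n : ℕ =>
      (kb n : ℝ) * (k n : ℝ) ^ 2 * Real.log ((k n : ℝ) ^ 2 / (n : ℝ)) / (n : ℝ) ^ 2) =
      fun n : ℕ => (k n : ℝ) ^ 2 / n * Real.log ((k n : ℝ) ^ 2 / n) / ((n : ℝ) / kb n) := by
    funext n
    rw [div_div_eq_mul_div]
    ring
  have h1ε : 0 < 1 - ε := sub_pos.2 hε1
  rw [hform]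
  refine ⟨6, by norm_num, fun h0 => ?_, fun hinf => ?_⟩
  · have hR := tendsto_mul_log_div_zero ht hs h0
    filter_upwards [hreg, eventually_gt_atTop 0, hord,
      hR.eventually_lt_const (by positivity : 0 < ε / 9216),
      hkbn.eventually_le_const (by positivity : 0 < (1 - ε) / 12),
      ht.eventually_gt_atTop (512 / (ε ^ 3 * (1 - ε))),
      ht.eventually_ge_atTop (4 / (1 - ε))] with n H hn0 hkk hRn hkn htn htn'
    have hn : (0 : ℝ) < n := by exact_mod_cast hn0
    have hk : (0 : ℝ) < k n := by exact_mod_cast H.k_pos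
    have hkb := H.kb_pos
    have hl := H.one_le_log
    have hkn' : (k n : ℝ) ≤ n := by exact_mod_cast hkk.1.trans hkk.2
    have hk4 : 4 ≤ (1 - ε) * k n := by
      rw [div_le_iff₀ h1ε, div_mul_eq_mul_div, le_div_iff₀ hn] at htn'
      have : (k n : ℝ) ^ 2 * (1 - ε) ≤ (n * k n) * (1 - ε) := by
        gcongr
        nlinarith
      nlinarith
    have hstart : 6 * (kb n : ℝ) * k n / n ≤ (1 - ε) * k n / 2 := by
      calc 6 * (kb n : ℝ) * k n / n = 6 * ((kb n : ℝ) / n) * k n := by ring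
        _ ≤ 6 * ((1 - ε) / 12) * k n := by gcongr
        _ = _ := by ring
    constructor
    · have hz := Nat.floor_le (by positivity : 0 ≤ 6 * (kb n : ℝ) * k n / n)
      have hz' := Nat.lt_floor_add_one (6 * (kb n : ℝ) * k n / n)
      have hle : ((⌊6 * (kb n : ℝ) * k n / n⌋₊ : ℕ) : ℝ) + 1 ≤ (1 - ε) * k n := by linarith
      have hdec := Gamma_succ_lt H hε hε1 hle hz'.le (by
        rw [lt_div_iff₀ (by norm_num)] at hRn
        calc 256 * (⌊6 * (kb n : ℝ) * k n / n⌋₊ : ℝ) ^ 2 * Real.log ((n : ℝ) / kb n)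
            ≤ 256 * (6 * (kb n : ℝ) * k n / n) ^ 2 * Real.log ((n : ℝ) / kb n) := by gcongr
          _ = ((k n : ℝ) ^ 2 / n * Real.log ((n : ℝ) / kb n) / ((n : ℝ) / kb n) * 9216) *
                kb n := by
              field_simp
              ring
          _ < ε * kb n := by gcongr)
      intro hmono
      refine absurd (hmono ⟨le_rfl, by linarith⟩ ⟨Nat.le_succ _, ?_⟩ (Nat.le_succ _)) hdec.not_ge
      exact_mod_cast hle
    · set z := ⌈(1 - ε) * k n / 2⌉₊ with hzdef
      have hz : (1 - ε) * k n / 2 ≤ z := Nat.le_ceil _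
      have hz' : (z : ℝ) < (1 - ε) * k n / 2 + 1 := Nat.ceil_lt_add_one (by positivity)
      have hle : (z : ℝ) + 1 ≤ (1 - ε) * k n := by linarith
      have hz1 : 1 ≤ z := Nat.one_le_ceil_iff.2 (by linarith)
      have hfl : ⌊6 * (kb n : ℝ) * k n / n⌋₊ ≤ z := Nat.floor_le_of_le (hstart.trans hz)
      have hinc := Gamma_lt_succ H hε hε1 hz1 hle (by
        calc 256 / ε ^ 3 = (1 - ε) / 2 * (512 / (ε ^ 3 * (1 - ε))) := by field_simp; norm_num
          _ < (1 - ε) / 2 * ((k n : ℝ) ^ 2 / n) := by gcongr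
          _ = ((1 - ε) * k n / 2) * k n * 1 / n := by ring
          _ ≤ _ := by gcongr)
      intro hanti
      refine absurd (hanti ⟨hfl, by linarith⟩ ⟨hfl.trans (Nat.le_succ _), ?_⟩ (Nat.le_succ _))
        hinc.not_ge
      exact_mod_cast hle
  · have hR := tendsto_mul_log_div_atTop ht hs hinf
    filter_upwards [hreg, eventually_gt_atTop 0, hR.eventually_gt_atTop (256 / ε ^ 3),
      ht.eventually_ge_atTop 1] with n H hn0 hRn htn
    have hn : (0 : ℝ) < n := by exact_mod_cast hn0
    have hk : (0 : ℝ) < k n := by exact_mod_cast H.k_pos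
    have hkb := H.kb_pos
    have hl := H.one_le_log
    have hkk : (k n : ℝ) ≤ kb n := by exact_mod_cast H.k_le
    have hbase : 1 ≤ (kb n : ℝ) * k n / n := by
      refine htn.trans ?_
      rw [pow_two]
      gcongr
    refine strictMonoOn_of_lt_add_one ?_ fun z _ hz hz1 => ?_
    · exact ⟨fun a ha b hb c hc => ⟨ha.1.trans hc.1, le_trans (by exact_mod_cast hc.2) hb.2⟩⟩
    have hzlow : (kb n : ℝ) * k n / n ≤ z := by
      have h1 := Nat.lt_floor_add_one (6 * (kb n : ℝ) * k n / n)
      have h2 : ((⌊6 * (kb n : ℝ) * k n / n⌋₊ : ℕ) : ℝ) ≤ z := by exact_mod_cast hz.1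
      have h3 : 6 * (kb n : ℝ) * k n / n = 6 * ((kb n : ℝ) * k n / n) := by ring
      linarith
    have hz1' := hz1.2
    push_cast at hz1'
    refine Gamma_lt_succ H hε hε1 (by exact_mod_cast hbase.trans hzlow) hz1' (hRn.trans_le ?_)
    calc (k n : ℝ) ^ 2 / n * Real.log ((n : ℝ) / kb n) / ((n : ℝ) / kb n)
        = ((kb n : ℝ) * k n / n) * k n * Real.log ((n : ℝ) / kb n) / n := by
          field_simp
      _ ≤ _ := by gcongr

end
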